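/- arXiv:1012.1301 — 2 statements merged into one kernel-verified Lean document; each statement's English description precedes it below -/
import Mathlib

section
/- Let σ ⊂ ℝ^d be a strongly convex polyhedral cone and let τ be a face of σ. Then ns(σ) ≥ ns(τ), i.e. |σ(1)| − dim σ ≥ |τ(1)| − dim τ. -/
open scoped BigOperators

noncomputable section

/-- The conical hull of a set `S` in `ℝ^d`: all finite nonnegative combinations of
elements of `S`.  For a finite set `S` this is the polyhedral cone `Cone(S)`. -/
def coneHull {d : ℕ} (S : Set (Fin d → ℝ)) : Set (Fin d → ℝ) :=
  {x | ∃ (T : Finset (Fin d → ℝ)) (c : (Fin d → ℝ) → ℝ),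
    ↑T ⊆ S ∧ (∀ v ∈ T, 0 ≤ c v) ∧ x = ∑ v ∈ T, c v • v}

/-- A polyhedral cone is the conical hull of a finite set. -/
def IsPolyhedralCone {d : ℕ} (σ : Set (Fin d → ℝ)) : Prop :=
  ∃ S : Finset (Fin d → ℝ), σ = coneHull ↑S

/-- A cone is strongly convex if it contains no line through the origin. -/
def StronglyConvex {d : ℕ} (σ : Set (Fin d → ℝ)) : Prop :=
  ∀ x ∈ σ, -x ∈ σ → x = 0

/-- `τ` is a face of `σ`: `τ = σ ∩ ker u` for a linear functional `u` nonnegative on `σ`. -/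
def IsFaceOf {d : ℕ} (σ τ : Set (Fin d → ℝ)) : Prop :=
  ∃ u : (Fin d → ℝ) →ₗ[ℝ] ℝ, (∀ x ∈ σ, 0 ≤ u x) ∧ τ = {x ∈ σ | u x = 0}

/-- The dimension of the linear span of a subset of `ℝ^d`. -/
def dimSet {d : ℕ} (s : Set (Fin d → ℝ)) : ℕ :=
  Module.finrank ℝ (Submodule.span ℝ s)

/-- The set of rays (one-dimensional faces) of a cone `σ`. -/
def raysOf {d : ℕ} (σ : Set (Fin d → ℝ)) : Set (Set (Fin d → ℝ)) :=
  {ρ | IsFaceOf σ ρ ∧ dimSet ρ = 1}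

/-- The non-simplicial index `ns(σ) = |σ(1)| − dim σ`. -/
def nsCone {d : ℕ} (σ : Set (Fin d → ℝ)) : ℤ :=
  ((raysOf σ).ncard : ℤ) - (dimSet σ : ℤ)


lemma mem_coneHull_finset {d : ℕ} (S : Finset (Fin d → ℝ)) (x : Fin d → ℝ) :
    x ∈ coneHull (S : Set (Fin d → ℝ)) ↔
      ∃ c : (Fin d → ℝ) → ℝ, (∀ v ∈ S, 0 ≤ c v) ∧ x = ∑ v ∈ S, c v • v := by
  classical
  constructor
  · rintro ⟨T, c, hT, hc, rfl⟩
    have hT' : T ⊆ S := by exact_mod_cast hT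
    refine ⟨fun v => if v ∈ T then c v else 0, ?_, ?_⟩
    · intro v _
      dsimp only
      split_ifs with h
      · exact hc v h
      · exact le_rfl
    · rw [← Finset.sum_subset hT']
      · apply Finset.sum_congr rfl
        intro v hv
        simp [hv]
      · intro v _ hv
        simp [hv]
  · rintro ⟨c, hc, rfl⟩
    exact ⟨S, c, subset_rfl, hc, rfl⟩

lemma coneHull_zero {d : ℕ} (S : Finset (Fin d → ℝ)) :
    (0 : Fin d → ℝ) ∈ coneHull (S : Set (Fin d → ℝ)) :=
  (mem_coneHull_finset S 0).2 ⟨fun _ => 0, by simp, by simp⟩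

lemma coneHull_add {d : ℕ} (S : Finset (Fin d → ℝ)) {x y : Fin d → ℝ}
    (hx : x ∈ coneHull (S : Set (Fin d → ℝ))) (hy : y ∈ coneHull (S : Set (Fin d → ℝ))) :
    x + y ∈ coneHull (S : Set (Fin d → ℝ)) := by
  rw [mem_coneHull_finset] at *
  obtain ⟨c, hc, rfl⟩ := hx
  obtain ⟨e, he, rfl⟩ := hy
  exact ⟨fun v => c v + e v, fun v hv => add_nonneg (hc v hv) (he v hv), by
    simp [add_smul, Finset.sum_add_distrib]⟩

lemma coneHull_smul {d : ℕ} (S : Finset (Fin d → ℝ)) {x : Fin d → ℝ} {a : ℝ} (ha : 0 ≤ a)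
    (hx : x ∈ coneHull (S : Set (Fin d → ℝ))) :
    a • x ∈ coneHull (S : Set (Fin d → ℝ)) := by
  rw [mem_coneHull_finset] at *
  obtain ⟨c, hc, rfl⟩ := hx
  exact ⟨fun v => a * c v, fun v hv => mul_nonneg ha (hc v hv), by
    simp [Finset.smul_sum, mul_smul]⟩

lemma coneHull_gen {d : ℕ} (S : Finset (Fin d → ℝ)) {x : Fin d → ℝ} (hx : x ∈ S) :
    x ∈ coneHull (S : Set (Fin d → ℝ)) :=
  ⟨{x}, fun _ => 1, by simpa using hx, by simp, by simp⟩

lemma coneHull_sum {d : ℕ} (S : Finset (Fin d → ℝ)) (T : Finset (Fin d → ℝ))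
    (c : (Fin d → ℝ) → ℝ) (hc : ∀ v ∈ T, 0 ≤ c v)
    (hT : ∀ v ∈ T, v ∈ coneHull (S : Set (Fin d → ℝ))) :
    ∑ v ∈ T, c v • v ∈ coneHull (S : Set (Fin d → ℝ)) := by
  classical
  induction T using Finset.induction_on with
  | empty => simpa using coneHull_zero S
  | insert a T ha ih =>
    rw [Finset.sum_insert ha]
    refine coneHull_add S (coneHull_smul S (hc _ (by simp)) (hT _ (by simp))) (ih ?_ ?_)
    · intro v hv; exact hc v (by simp [hv])
    · intro v hv; exact hT v (by simp [hv])

lemma coneHull_le {d : ℕ} (S T : Finset (Fin d → ℝ))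
    (hT : ∀ v ∈ T, v ∈ coneHull (S : Set (Fin d → ℝ))) :
    coneHull (T : Set (Fin d → ℝ)) ⊆ coneHull (S : Set (Fin d → ℝ)) := by
  intro x hx
  obtain ⟨c, hc, rfl⟩ := (mem_coneHull_finset T x).1 hx
  exact coneHull_sum S T c hc hT

lemma exists_minimal_gen {d : ℕ} [DecidableEq (Fin d → ℝ)] (S : Finset (Fin d → ℝ)) :
    ∃ T : Finset (Fin d → ℝ), coneHull (S : Set (Fin d → ℝ)) = coneHull (T : Set (Fin d → ℝ)) ∧
      ∀ s ∈ T, s ∉ coneHull ((T.erase s : Finset (Fin d → ℝ)) : Set (Fin d → ℝ)) := by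
  induction S using Finset.strongInduction with
  | H S ih =>
    by_cases h : ∀ s ∈ S, s ∉ coneHull ((S.erase s : Finset (Fin d → ℝ)) : Set (Fin d → ℝ))
    · exact ⟨S, rfl, h⟩
    · push Not at h
      obtain ⟨s, hs, hs'⟩ := h
      obtain ⟨T, hT, hT'⟩ := ih _ (Finset.erase_ssubset hs)
      refine ⟨T, ?_, hT'⟩
      rw [← hT]
      apply subset_antisymm
      · apply coneHull_le
        intro v hv
        by_cases hvs : v = s
        · rw [hvs]; exact hs'
        · exact coneHull_gen _ (Finset.mem_erase.2 ⟨hvs, hv⟩)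
      · apply coneHull_le
        intro v hv
        exact coneHull_gen _ (Finset.mem_of_mem_erase hv)

lemma face_gen {d : ℕ} (S : Finset (Fin d → ℝ)) (u : (Fin d → ℝ) →ₗ[ℝ] ℝ)
    (hu : ∀ v ∈ S, 0 ≤ u v) [DecidablePred fun v => u v = 0] :
    {x ∈ coneHull (S : Set (Fin d → ℝ)) | u x = 0} =
      coneHull ((S.filter fun v => u v = 0 : Finset (Fin d → ℝ)) : Set (Fin d → ℝ)) := by
  ext x
  constructor
  · rintro ⟨hx, hux⟩
    obtain ⟨c, hc, rfl⟩ := (mem_coneHull_finset S x).1 hx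
    rw [map_sum, Finset.sum_eq_zero_iff_of_nonneg] at hux
    · rw [mem_coneHull_finset]
      refine ⟨c, fun v hv => hc v (Finset.mem_filter.1 hv).1, ?_⟩
      rw [Finset.sum_filter]
      apply Finset.sum_congr rfl
      intro v hv
      split_ifs with h
      · rfl
      · have := hux v hv
        rw [map_smul, smul_eq_mul] at this
        rcases mul_eq_zero.1 this with h' | h'
        · simp [h']
        · exact absurd h' h
    · intro v hv
      rw [map_smul, smul_eq_mul]
      exact mul_nonneg (hc v hv) (hu v hv)
  · intro hx
    refine ⟨coneHull_le S _ (fun v hv => coneHull_gen _ (Finset.mem_filter.1 hv).1) hx, ?_⟩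
    obtain ⟨c, hc, rfl⟩ := (mem_coneHull_finset _ x).1 hx
    rw [map_sum]
    apply Finset.sum_eq_zero
    intro v hv
    rw [map_smul, (Finset.mem_filter.1 hv).2, smul_zero]

lemma span_coneHull {d : ℕ} (S : Finset (Fin d → ℝ)) :
    Submodule.span ℝ (coneHull (S : Set (Fin d → ℝ))) =
      Submodule.span ℝ (S : Set (Fin d → ℝ)) := by
  apply le_antisymm
  · rw [Submodule.span_le]
    intro x hx
    obtain ⟨c, hc, rfl⟩ := (mem_coneHull_finset S x).1 hx
    exact Submodule.sum_mem _ fun v hv =>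
      Submodule.smul_mem _ _ (Submodule.subset_span (by exact_mod_cast hv))
  · exact Submodule.span_mono fun x hx => coneHull_gen S (by exact_mod_cast hx)

lemma rays_sub {d : ℕ} [DecidableEq (Fin d → ℝ)] (S : Finset (Fin d → ℝ))
    (hsc : StronglyConvex (coneHull (S : Set (Fin d → ℝ)))) :
    raysOf (coneHull (S : Set (Fin d → ℝ))) ⊆
      (fun s => coneHull (({s} : Finset (Fin d → ℝ)) : Set (Fin d → ℝ))) ''
        (S : Set (Fin d → ℝ)) := by
  classical
  rintro ρ ⟨⟨u, hu, rfl⟩, hdim⟩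
  have hfg := face_gen S u (fun v hv => hu v (coneHull_gen S hv))
  set ρ := {x ∈ coneHull (S : Set (Fin d → ℝ)) | u x = 0} with hρ
  have hex : ∃ s ∈ S.filter (fun v => u v = 0), s ≠ 0 := by
    by_contra hcon
    push Not at hcon
    have : Submodule.span ℝ ρ = ⊥ := by
      rw [hfg, span_coneHull, Submodule.span_eq_bot]
      intro x hx
      exact hcon x (by exact_mod_cast hx)
    rw [dimSet, this] at hdim
    simp at hdim
  obtain ⟨s, hs, hs0⟩ := hex
  refine ⟨s, by exact_mod_cast (Finset.mem_filter.1 hs).1, ?_⟩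
  dsimp only
  apply subset_antisymm
  · rw [hfg]
    apply coneHull_le
    intro v hv
    rw [Finset.mem_singleton.1 hv]
    exact coneHull_gen _ hs
  · intro x hx
    have hsρ : s ∈ Submodule.span ℝ ρ := by
      apply Submodule.subset_span
      rw [hfg]; exact coneHull_gen _ hs
    have hxρ : x ∈ Submodule.span ℝ ρ := Submodule.subset_span hx
    have h1 := (finrank_eq_one_iff_of_nonzero' (⟨s, hsρ⟩ : Submodule.span ℝ ρ)
      (by simpa using hs0)).1 hdim ⟨x, hxρ⟩
    obtain ⟨c, hc⟩ := h1
    have hc' : c • s = x := congrArg Subtype.val hc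
    rcases le_total 0 c with h | h
    · rw [← hc']
      exact coneHull_smul _ h (coneHull_gen _ (by simp))
    · have : x = 0 := by
        apply hsc x hx.1
        rw [← hc', ← neg_smul]
        exact coneHull_smul _ (by linarith) (coneHull_gen _ (Finset.mem_filter.1 hs).1)
      rw [this]
      exact coneHull_zero _

lemma exists_functional {d : ℕ} [DecidableEq (Fin d → ℝ)] (S : Finset (Fin d → ℝ))
    (hsc : StronglyConvex (coneHull (S : Set (Fin d → ℝ))))
    (hmin : ∀ s ∈ S, s ∉ coneHull ((S.erase s : Finset (Fin d → ℝ)) : Set (Fin d → ℝ)))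
    (s : Fin d → ℝ) (hs : s ∈ S) :
    ∃ u : (Fin d → ℝ) →ₗ[ℝ] ℝ, u s = 0 ∧ ∀ t ∈ S, t ≠ s → 0 < u t := by
  have hdisj : Disjoint (convexHull ℝ ((S.erase s : Finset (Fin d → ℝ)) : Set (Fin d → ℝ)))
      ((Submodule.span ℝ {s} : Submodule ℝ (Fin d → ℝ)) : Set (Fin d → ℝ)) := by
    rw [Set.disjoint_left]
    intro x hx hxs
    obtain ⟨w, hw0, hw1, hwx⟩ := Finset.mem_convexHull'.1 hx
    obtain ⟨a, ha⟩ := Submodule.mem_span_singleton.1 hxs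
    rcases lt_or_ge 0 a with h | h
    · apply hmin s hs
      have hxc : x ∈ coneHull ((S.erase s : Finset (Fin d → ℝ)) : Set (Fin d → ℝ)) :=
        (mem_coneHull_finset _ x).2 ⟨w, hw0, hwx.symm⟩
      have : s = a⁻¹ • x := by rw [← ha, smul_smul, inv_mul_cancel₀ h.ne', one_smul]
      rw [this]
      exact coneHull_smul _ (by positivity) (this ▸ hxc)
    · obtain ⟨t, ht, hwt⟩ : ∃ t ∈ S.erase s, 0 < w t := by
        by_contra hcon
        push Not at hcon
        have := Finset.sum_nonpos hcon
        linarith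
      have htS := Finset.mem_of_mem_erase ht
      have hneg : -(w t • t) = (∑ y ∈ (S.erase s).erase t, w y • y) + (-a) • s := by
        rw [← Finset.add_sum_erase _ _ ht] at hwx
        rw [neg_smul, ha, ← hwx]
        abel
      have h0 : w t • t = 0 := by
        apply hsc
        · exact coneHull_smul _ hwt.le (coneHull_gen _ htS)
        · rw [hneg]
          apply coneHull_add
          · apply coneHull_sum
            · intro v hv; exact hw0 v (Finset.mem_of_mem_erase hv)
            · intro v hv
              exact coneHull_gen _ (Finset.mem_of_mem_erase (Finset.mem_of_mem_erase hv))
          · exact coneHull_smul _ (by linarith) (coneHull_gen _ hs)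
      have ht0 : t = 0 := (smul_eq_zero.1 h0).resolve_left hwt.ne'
      apply hmin t htS
      have := coneHull_zero (S.erase t)
      rw [ht0] at this ⊢
      exact this
  obtain ⟨f, p, q, hf1, hpq, hf2⟩ := geometric_hahn_banach_compact_closed
    (convex_convexHull ℝ _) (Set.Finite.isCompact_convexHull ℝ (Finset.finite_toSet (S.erase s)))
    (Submodule.convex _) (Submodule.closed_of_finiteDimensional (Submodule.span ℝ {s})) hdisj
  have hq : q < 0 := by simpa using hf2 0 (Submodule.zero_mem _)
  refine ⟨-(f : (Fin d → ℝ) →ₗ[ℝ] ℝ), ?_, ?_⟩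
  · by_contra hne
    have hne' : f s ≠ 0 := by simpa using hne
    have := hf2 ((q / f s) • s) (Submodule.smul_mem _ _ (Submodule.mem_span_singleton_self s))
    rw [map_smul, smul_eq_mul, div_mul_cancel₀ _ hne'] at this
    exact lt_irrefl _ this
  · intro t ht hts
    have := hf1 t (subset_convexHull ℝ _ (by simp [ht, hts]))
    simp
    linarith

lemma rays_sup {d : ℕ} [DecidableEq (Fin d → ℝ)] (S : Finset (Fin d → ℝ))
    (hsc : StronglyConvex (coneHull (S : Set (Fin d → ℝ))))
    (hmin : ∀ s ∈ S, s ∉ coneHull ((S.erase s : Finset (Fin d → ℝ)) : Set (Fin d → ℝ))) :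
    (fun s => coneHull (({s} : Finset (Fin d → ℝ)) : Set (Fin d → ℝ))) ''
        (S : Set (Fin d → ℝ)) ⊆ raysOf (coneHull (S : Set (Fin d → ℝ))) := by
  classical
  rintro _ ⟨s, hs, rfl⟩
  have hs : s ∈ S := by exact_mod_cast hs
  obtain ⟨u, hus, hu⟩ := exists_functional S hsc hmin s hs
  have hu0 : ∀ v ∈ S, 0 ≤ u v := by
    intro v hv
    by_cases h : v = s
    · rw [h, hus]
    · exact (hu v hv h).le
  have hfil : S.filter (fun v => u v = 0) = {s} := by
    ext v
    simp only [Finset.mem_filter, Finset.mem_singleton]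
    constructor
    · rintro ⟨hv, h⟩
      by_contra hvs
      exact (hu v hv hvs).ne' h
    · rintro rfl
      exact ⟨hs, hus⟩
  refine ⟨⟨u, ?_, ?_⟩, ?_⟩
  · intro x hx
    obtain ⟨c, hc, rfl⟩ := (mem_coneHull_finset S x).1 hx
    rw [map_sum]
    apply Finset.sum_nonneg
    intro v hv
    rw [map_smul, smul_eq_mul]
    exact mul_nonneg (hc v hv) (hu0 v hv)
  · rw [face_gen S u hu0, hfil]
  · have hs0 : s ≠ 0 := by
      intro h
      apply hmin s hs
      have := coneHull_zero (S.erase s)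
      rw [h] at this ⊢
      exact this
    dsimp only
    rw [dimSet, span_coneHull, Finset.coe_singleton]
    exact finrank_span_singleton hs0

lemma cone_inj {d : ℕ} [DecidableEq (Fin d → ℝ)] (S : Finset (Fin d → ℝ))
    (hmin : ∀ s ∈ S, s ∉ coneHull ((S.erase s : Finset (Fin d → ℝ)) : Set (Fin d → ℝ))) :
    Set.InjOn (fun s => coneHull (({s} : Finset (Fin d → ℝ)) : Set (Fin d → ℝ)))
        (S : Set (Fin d → ℝ)) := by
  intro s hs t ht hst
  by_contra hne
  dsimp only at hst
  apply hmin s (by exact_mod_cast hs)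
  have h1 : s ∈ coneHull (({s} : Finset (Fin d → ℝ)) : Set (Fin d → ℝ)) :=
    coneHull_gen _ (by simp)
  rw [hst] at h1
  refine coneHull_le _ _ ?_ h1
  intro v hv
  rw [Finset.mem_singleton.1 hv]
  exact coneHull_gen _ (Finset.mem_erase.2 ⟨fun h => hne h.symm, by exact_mod_cast ht⟩)

theorem stmt0 {d : ℕ} (σ τ : Set (Fin d → ℝ)) (hσ : IsPolyhedralCone σ)
    (hsc : StronglyConvex σ) (hτ : IsFaceOf σ τ) :
    nsCone τ ≤ nsCone σ := by
  classical
  obtain ⟨S₀, rfl⟩ := hσ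
  obtain ⟨S, hS, hmin⟩ := exists_minimal_gen S₀
  rw [hS] at hsc hτ ⊢
  obtain ⟨u, hu, rfl⟩ := hτ
  rw [face_gen S u (fun v hv => hu v (coneHull_gen S hv))]
  set S' := S.filter (fun v => u v = 0) with hS'
  have hsub : S' ⊆ S := Finset.filter_subset _ _
  have hsc' : StronglyConvex (coneHull (S' : Set (Fin d → ℝ))) := by
    have hle := coneHull_le S S' (fun v hv => coneHull_gen _ (hsub hv))
    intro x hx hx'
    exact hsc x (hle hx) (hle hx')
  have hcard : (raysOf (coneHull (S : Set (Fin d → ℝ)))).ncard = S.card := by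
    rw [subset_antisymm (rays_sub S hsc) (rays_sup S hsc hmin),
      (cone_inj S hmin).ncard_image, Set.ncard_coe_finset]
  have hcard' : (raysOf (coneHull (S' : Set (Fin d → ℝ)))).ncard ≤ S'.card := by
    refine (Set.ncard_le_ncard (rays_sub S' hsc') (S'.finite_toSet.image _)).trans ?_
    refine (Set.ncard_image_le S'.finite_toSet).trans ?_
    rw [Set.ncard_coe_finset]
  have hdim : dimSet (coneHull (S : Set (Fin d → ℝ))) ≤
      dimSet (coneHull (S' : Set (Fin d → ℝ))) + (S \ S').card := by
    rw [dimSet, dimSet, span_coneHull, span_coneHull]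
    have : (S : Set (Fin d → ℝ)) = (S' : Set (Fin d → ℝ)) ∪ ((S \ S' : Finset _) : Set _) := by
      rw [← Finset.coe_union, Finset.union_sdiff_of_subset hsub]
    rw [this, Submodule.span_union]
    refine (Submodule.finrank_add_le_finrank_add_finrank _ _).trans ?_
    gcongr
    exact finrank_span_finset_le_card _
  have hc := Finset.card_sdiff_add_card_eq_card hsub
  unfold nsCone
  omega
end
end

section
/- Let Σ be a fan in ℝ^d, let σ be a minimal non-simplicial cone of Σ (so ns(σ) = ns(Σ) > 0), and let v0 = ∑_{ρ∈σ(1)} v_ρ, where for each ray ρ of σ a nonzero point v_ρ ∈ ρ is chosen (so v0 lies in the relative interior of σ). Then every new cone of the star subdivision Σ_σ at v0, i.e. every cone of the form τ' = Cone(τ ∪ {v0}) where μ is a cone of Σ containing σ and τ is a face of μ not containing σ, satisfies ns(τ') < ns(σ). -/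
open scoped BigOperators

noncomputable section

/-- A fan in `ℝ^d`: a finite collection of strongly convex polyhedral cones, closed
under taking faces, such that the intersection of any two cones is a face of each. -/
def IsFan {d : ℕ} (F : Set (Set (Fin d → ℝ))) : Prop :=
  F.Finite ∧ (∀ σ ∈ F, IsPolyhedralCone σ ∧ StronglyConvex σ) ∧
    (∀ σ ∈ F, ∀ τ, IsFaceOf σ τ → τ ∈ F) ∧
    (∀ σ ∈ F, ∀ σ' ∈ F, IsFaceOf σ (σ ∩ σ') ∧ IsFaceOf σ' (σ ∩ σ'))

/-- The non-simplicial index of a fan: `ns(Σ) = max_{σ ∈ Σ} ns(σ)`. -/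
def nsFan {d : ℕ} (F : Set (Set (Fin d → ℝ))) : ℤ :=
  sSup (nsCone '' F)

/-- A minimal non-simplicial cone of a fan `F`: a cone of `F` whose non-simplicial index
equals `ns(F)` and which is minimal with respect to inclusion among such cones. -/
def IsMinNonSimpCone {d : ℕ} (F : Set (Set (Fin d → ℝ))) (σ : Set (Fin d → ℝ)) : Prop :=
  σ ∈ F ∧ nsCone σ = nsFan F ∧
    ∀ τ ∈ F, nsCone τ = nsFan F → τ ⊆ σ → τ = σ

/-- The star subdivision of the fan `F` along the cone `σ` at the point `v0` (a point of
the relative interior of `σ`): it consists of the cones of `F` not containing `σ`,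
together with the cones `Cone(τ ∪ {v0})` for `μ` a cone of `F` containing `σ` and
`τ` a face of `μ` not containing `σ`. -/
def starSubdiv {d : ℕ} (F : Set (Set (Fin d → ℝ))) (σ : Set (Fin d → ℝ))
    (v0 : Fin d → ℝ) : Set (Set (Fin d → ℝ)) :=
  {μ ∈ F | ¬ σ ⊆ μ} ∪
    {c | ∃ μ ∈ F, σ ⊆ μ ∧ ∃ τ, IsFaceOf μ τ ∧ ¬ σ ⊆ τ ∧ c = coneHull (τ ∪ {v0})}

lemma coneHull_eq_span {d : ℕ} (S : Set (Fin d → ℝ)) :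
    coneHull S = (Submodule.span NNReal S : Set (Fin d → ℝ)) := by
  ext x
  constructor
  · rintro ⟨T, c, hT, hc, rfl⟩
    refine Submodule.sum_mem _ fun t ht => ?_
    have := Submodule.smul_mem (Submodule.span NNReal S) (⟨c t, hc t ht⟩ : NNReal)
      (Submodule.subset_span (hT ht))
    exact this
  · intro hx
    obtain ⟨T, hT, hx⟩ := Submodule.mem_span_finite_of_mem_span hx
    obtain ⟨f, -, rfl⟩ := Submodule.mem_span_finset.1 hx
    exact ⟨T, fun t => (f t : ℝ), hT, fun t _ => (f t).2, rfl⟩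

lemma exists_expose {d : ℕ} (T : Finset (Fin d → ℝ)) (s : Fin d → ℝ)
    (h : ∀ c : (Fin d → ℝ) → ℝ, (∀ t ∈ T, 0 ≤ c t) → ∑ t ∈ T, c t = 1 →
      ∀ l : ℝ, ∑ t ∈ T, c t • t ≠ l • s) :
    ∃ u : (Fin d → ℝ) →ₗ[ℝ] ℝ, u s = 0 ∧ ∀ t ∈ T, 0 < u t := by
  have hd : Disjoint (convexHull ℝ (T : Set (Fin d → ℝ)))
      ((Submodule.span ℝ {s} : Submodule ℝ (Fin d → ℝ)) : Set (Fin d → ℝ)) := by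
    rw [Set.disjoint_left]
    intro x hx hx'
    obtain ⟨l, rfl⟩ := Submodule.mem_span_singleton.1 hx'
    rw [Finset.mem_convexHull'] at hx
    obtain ⟨c, h0, h1, h2⟩ := hx
    exact h c h0 h1 l h2
  obtain ⟨f, a, b, h1, hab, h2⟩ := geometric_hahn_banach_compact_closed
    (convex_convexHull ℝ _) (T.finite_toSet.isCompact_convexHull (𝕜 := ℝ))
    (Submodule.convex (Submodule.span ℝ {s})) (Submodule.closed_of_finiteDimensional _) hd
  have hs : f s = 0 := by
    by_contra hne
    have := h2 (((b - 1) / f s) • s) (Submodule.smul_mem _ _ (Submodule.mem_span_singleton_self s))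
    rw [map_smul, smul_eq_mul, div_mul_cancel₀ _ hne] at this
    linarith
  have hb : b < 0 := by
    have := h2 0 (Submodule.zero_mem _)
    simpa using this
  refine ⟨-(f : (Fin d → ℝ) →ₗ[ℝ] ℝ), by simp [hs], fun t ht => ?_⟩
  have := h1 t (subset_convexHull ℝ _ ht)
  simp only [LinearMap.neg_apply, ContinuousLinearMap.coe_coe]
  linarith

lemma span_rays {d : ℕ} (σ : Set (Fin d → ℝ)) (h1 : IsPolyhedralCone σ) (h2 : StronglyConvex σ) :
    Submodule.span ℝ (⋃₀ raysOf σ) = Submodule.span ℝ σ := by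
  classical
  apply le_antisymm
  · refine Submodule.span_mono (Set.sUnion_subset ?_)
    rintro ρ ⟨⟨u, -, rfl⟩, -⟩
    exact fun x hx => hx.1
  have hex : ∃ n, ∃ S : Finset (Fin d → ℝ), S.card = n ∧ σ = coneHull (S : Set (Fin d → ℝ)) := by
    obtain ⟨S, hS⟩ := h1
    exact ⟨_, S, rfl, hS⟩
  obtain ⟨S, hSc, hS⟩ := Nat.find_spec hex
  have hmin : ∀ s ∈ S, s ∉ Submodule.span NNReal ((S.erase s : Finset _) : Set (Fin d → ℝ)) := by
    intro s hs hmem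
    have hlt : (S.erase s).card < Nat.find hex := by
      rw [← hSc]; exact Finset.card_erase_lt_of_mem hs
    apply Nat.find_min hex hlt
    refine ⟨_, rfl, ?_⟩
    rw [hS, coneHull_eq_span, coneHull_eq_span, ← Submodule.span_insert_eq_span hmem,
      ← Finset.coe_insert, Finset.insert_erase hs]
  have hσ : ∀ x, x ∈ σ ↔ x ∈ Submodule.span NNReal (S : Set (Fin d → ℝ)) := by
    intro x; rw [hS, coneHull_eq_span]; rfl
  have key : ∀ s ∈ S, s ∈ ⋃₀ raysOf σ := by
    intro s hs
    have hs0 : ∀ t ∈ S, t ≠ 0 := by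
      rintro t ht rfl
      exact hmin 0 ht (Submodule.zero_mem _)
    obtain ⟨u, hus, hu⟩ := exists_expose (S.erase s) s (by
      intro c hc hc1 l hl
      rcases lt_or_ge 0 l with hl0 | hl0
      · apply hmin s hs
        have : s = ∑ t ∈ S.erase s, (l⁻¹ * c t) • t := by
          simp_rw [mul_smul]
          rw [← Finset.smul_sum, hl, smul_smul, inv_mul_cancel₀ hl0.ne', one_smul]
        rw [← SetLike.mem_coe, ← coneHull_eq_span]
        exact ⟨_, _, subset_rfl, fun t ht => mul_nonneg (inv_nonneg.2 hl0.le) (hc t ht), this⟩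
      · obtain ⟨t, ht, hct⟩ : ∃ t ∈ S.erase s, c t ≠ 0 := by
          by_contra! hcon
          rw [Finset.sum_eq_zero hcon] at hc1
          exact zero_ne_one hc1
        have htS := Finset.mem_of_mem_erase ht
        have hm : ∀ t ∈ S, ∀ a : ℝ, 0 ≤ a → a • t ∈ Submodule.span NNReal (S : Set (Fin d → ℝ)) :=
          fun t ht a ha => Submodule.smul_mem _ (⟨a, ha⟩ : NNReal) (Submodule.subset_span ht)
        have hz := h2 (c t • t) ((hσ _).2 (hm t htS _ (hc t ht))) ((hσ _).2 (by
          have : -(c t • t) = ∑ r ∈ (S.erase s).erase t, c r • r + (-l) • s := by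
            rw [← Finset.add_sum_erase _ _ ht] at hl
            rw [neg_smul, ← hl]; abel
          rw [this]
          refine Submodule.add_mem _ (Submodule.sum_mem _ fun r hr => ?_) (hm s hs _ (by linarith))
          have hr' := Finset.mem_of_mem_erase hr
          exact hm r (Finset.mem_of_mem_erase hr') _ (hc r hr')))
        rcases smul_eq_zero.1 hz with h | h
        · exact hct h
        · exact hs0 t htS h)
    have hpos : ∀ t ∈ S, 0 ≤ u t := by
      intro t ht
      by_cases hts : t = s
      · rw [hts, hus]
      · exact (hu t (Finset.mem_erase.2 ⟨hts, ht⟩)).le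
    have hsρ : s ∈ {x ∈ σ | u x = 0} := ⟨(hσ s).2 (Submodule.subset_span hs), hus⟩
    refine ⟨{x ∈ σ | u x = 0}, ⟨⟨u, ?_, rfl⟩, ?_⟩, hsρ⟩
    · intro x hx
      obtain ⟨f, -, rfl⟩ := Submodule.mem_span_finset.1 ((hσ x).1 hx)
      rw [map_sum]
      refine Finset.sum_nonneg fun t ht => ?_
      rw [NNReal.smul_def, map_smul]
      exact mul_nonneg (f t).2 (hpos t ht)
    · have : Submodule.span ℝ {x ∈ σ | u x = 0} = Submodule.span ℝ {s} := by
        apply le_antisymm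
        · rw [Submodule.span_le]
          rintro x ⟨hx, hux⟩
          obtain ⟨f, -, rfl⟩ := Submodule.mem_span_finset.1 ((hσ x).1 hx)
          rw [map_sum] at hux
          have hnn : ∀ t ∈ S, 0 ≤ u (f t • t) := by
            intro t ht
            rw [NNReal.smul_def, map_smul]
            exact mul_nonneg (f t).2 (hpos t ht)
          rw [Finset.sum_eq_zero_iff_of_nonneg hnn] at hux
          refine Submodule.sum_mem _ fun t ht => ?_
          by_cases hts : t = s
          · rw [hts, NNReal.smul_def]
            exact Submodule.smul_mem _ _ (Submodule.mem_span_singleton_self s)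
          · have h0 := hux t ht
            rw [NNReal.smul_def, map_smul, smul_eq_mul] at h0
            rcases mul_eq_zero.1 h0 with h | h
            · rw [NNReal.smul_def, h, zero_smul]; exact Submodule.zero_mem _
            · exact absurd h (hu t (Finset.mem_erase.2 ⟨hts, ht⟩)).ne'
        · exact Submodule.span_mono (Set.singleton_subset_iff.2 hsρ)
      rw [dimSet, this]
      exact finrank_span_singleton (hs0 s hs)
  rw [Submodule.span_le]
  intro x hx
  obtain ⟨f, -, rfl⟩ := Submodule.mem_span_finset.1 ((hσ x).1 hx)
  refine Submodule.sum_mem _ fun t ht => ?_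
  rw [NNReal.smul_def]
  exact Submodule.smul_mem _ _ (Submodule.subset_span (key t ht))

lemma dim_sUnion_le {d : ℕ} (C : Set (Set (Fin d → ℝ))) (hC : C.Finite)
    (h : ∀ ρ ∈ C, dimSet ρ = 1) : dimSet (⋃₀ C) ≤ C.ncard := by
  induction C, hC using Set.Finite.induction_on with
  | empty => simp [dimSet]
  | @insert a s ha hs ih =>
    rw [Set.ncard_insert_of_notMem ha hs, Set.sUnion_insert, dimSet, Submodule.span_union]
    have h1 := ih fun ρ hρ => h ρ (Set.mem_insert_of_mem _ hρ)
    have h2 := h a (Set.mem_insert _ _)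
    have h3 := Submodule.finrank_add_le_finrank_add_finrank
      (Submodule.span ℝ a) (Submodule.span ℝ (⋃₀ s))
    rw [dimSet] at h1 h2
    omega

lemma raysOf_fan {d : ℕ} {F : Set (Set (Fin d → ℝ))} (hF : IsFan F) {σ : Set (Fin d → ℝ)}
    (hσ : σ ∈ F) : raysOf σ = {ρ | ρ ∈ F ∧ dimSet ρ = 1 ∧ ρ ⊆ σ} := by
  ext ρ
  constructor
  · rintro ⟨h1, h2⟩
    refine ⟨hF.2.2.1 σ hσ ρ h1, h2, ?_⟩
    obtain ⟨u, -, rfl⟩ := h1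
    exact fun x hx => hx.1
  · rintro ⟨h1, h2, h3⟩
    refine ⟨?_, h2⟩
    have := (hF.2.2.2 σ hσ ρ h1).1
    rwa [Set.inter_eq_right.2 h3] at this

lemma ns_super {d : ℕ} {F : Set (Set (Fin d → ℝ))} (hF : IsFan F) {σ τ μ : Set (Fin d → ℝ)}
    (hσ : σ ∈ F) (hτ : τ ∈ F) (hμ : μ ∈ F) (hγ : σ ∩ τ ∈ F) (h1 : σ ⊆ μ) (h2 : τ ⊆ μ) :
    nsCone σ + nsCone τ ≤ nsCone (σ ∩ τ) + nsCone μ := by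
  have hdim : ∀ κ ∈ F, dimSet κ = dimSet (⋃₀ raysOf κ) := by
    intro κ hκ
    rw [dimSet, dimSet, span_rays κ (hF.2.1 κ hκ).1 (hF.2.1 κ hκ).2]
  have hfin : ∀ κ ∈ F, (raysOf κ).Finite := by
    intro κ hκ
    rw [raysOf_fan hF hκ]
    exact hF.1.subset fun x hx => hx.1
  have hI : raysOf (σ ∩ τ) = raysOf σ ∩ raysOf τ := by
    rw [raysOf_fan hF hσ, raysOf_fan hF hτ, raysOf_fan hF hγ]
    ext ρ
    simp only [Set.mem_ofPred_eq, Set.mem_inter_iff, Set.subset_inter_iff]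
    tauto
  have hU : raysOf σ ∪ raysOf τ ⊆ raysOf μ := by
    rw [raysOf_fan hF hσ, raysOf_fan hF hτ, raysOf_fan hF hμ]
    rintro ρ (⟨a, b, c⟩ | ⟨a, b, c⟩)
    · exact ⟨a, b, c.trans h1⟩
    · exact ⟨a, b, c.trans h2⟩
  have c1 := Set.ncard_union_add_ncard_inter (raysOf σ) (raysOf τ) (hfin σ hσ) (hfin τ hτ)
  have c2 := Set.ncard_sdiff_add_ncard_of_subset hU (hfin μ hμ)
  have d1 : dimSet (⋃₀ (raysOf σ ∪ raysOf τ)) + dimSet (⋃₀ raysOf (σ ∩ τ)) ≤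
      dimSet (⋃₀ raysOf σ) + dimSet (⋃₀ raysOf τ) := by
    simp only [dimSet]
    rw [← Submodule.finrank_sup_add_finrank_inf_eq (Submodule.span ℝ (⋃₀ raysOf σ)), Set.sUnion_union, Submodule.span_union, hI]
    refine Nat.add_le_add_left (Submodule.finrank_mono (R := ℝ) (le_inf ?_ ?_)) _
    · exact Submodule.span_mono (Set.sUnion_mono Set.inter_subset_left)
    · exact Submodule.span_mono (Set.sUnion_mono Set.inter_subset_right)
  have d2 : dimSet (⋃₀ raysOf μ) ≤ (raysOf μ \ (raysOf σ ∪ raysOf τ)).ncard +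
      dimSet (⋃₀ (raysOf σ ∪ raysOf τ)) := by
    have e := dim_sUnion_le (raysOf μ \ (raysOf σ ∪ raysOf τ)) ((hfin μ hμ).subset Set.sdiff_subset)
      fun ρ hρ => hρ.1.2
    refine le_trans ?_ (Nat.add_le_add_right e _)
    simp only [dimSet]
    refine le_trans ?_ (Submodule.finrank_add_le_finrank_add_finrank _ _)
    rw [← Submodule.span_union, ← Set.sUnion_union,
      Set.sdiff_union_of_subset hU]
  rw [← hdim μ hμ] at d2
  rw [← hdim σ hσ, ← hdim τ hτ, ← hdim _ hγ] at d1
  rw [← hI] at c1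
  simp only [nsCone]
  omega

lemma ns_cone_le {d : ℕ} (τ : Set (Fin d → ℝ)) (v0 : Fin d → ℝ) (K : Submodule NNReal (Fin d → ℝ))
    (hK : τ = K) (hfin : (raysOf τ).Finite) (u : (Fin d → ℝ) →ₗ[ℝ] ℝ)
    (hu : ∀ x ∈ τ, u x = 0) (hv : 0 < u v0) :
    nsCone (coneHull (τ ∪ {v0})) ≤ nsCone τ := by
  have hmem : ∀ x, x ∈ coneHull (τ ∪ {v0}) ↔ ∃ a : NNReal, ∃ t ∈ τ, x = a • v0 + t := by
    intro x
    rw [coneHull_eq_span, SetLike.mem_coe, Set.union_singleton, Submodule.mem_span_insert, hK,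
      Submodule.span_eq]
    rfl
  have h0 : (0 : Fin d → ℝ) ∈ τ := by rw [hK]; exact K.zero_mem
  have hv0 : v0 ∈ coneHull (τ ∪ {v0}) := (hmem _).2 ⟨1, 0, h0, by simp⟩
  have hsub : τ ⊆ coneHull (τ ∪ {v0}) := fun x hx => (hmem _).2 ⟨0, x, hx, by simp⟩
  have hrays : raysOf (coneHull (τ ∪ {v0})) ⊆
      insert {x | ∃ a : NNReal, x = a • v0} (raysOf τ) := by
    rintro ρ ⟨⟨w, hw, rfl⟩, hd⟩
    by_cases hwv : w v0 = 0
    · left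
      have hvne : v0 ≠ 0 := by rintro rfl; simp at hv
      have hsp : Submodule.span ℝ {v0} =
          Submodule.span ℝ {x ∈ coneHull (τ ∪ {v0}) | w x = 0} := by
        apply Submodule.eq_of_le_of_finrank_eq
        · exact Submodule.span_mono (Set.singleton_subset_iff.2 ⟨hv0, hwv⟩)
        · rw [finrank_span_singleton hvne]; exact hd.symm
      ext x
      constructor
      · intro hx
        have hx' : x ∈ Submodule.span ℝ {v0} := hsp ▸ Submodule.subset_span hx
        obtain ⟨a, rfl⟩ := Submodule.mem_span_singleton.1 hx'
        obtain ⟨b, t, ht, he⟩ := (hmem _).1 hx.1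
        have := congrArg u he
        rw [map_smul, map_add, hu t ht, NNReal.smul_def, map_smul, add_zero, smul_eq_mul,
          smul_eq_mul] at this
        have := mul_right_cancel₀ hv.ne' this
        exact ⟨b, by rw [this]; rfl⟩
      · rintro ⟨a, rfl⟩
        refine ⟨(hmem _).2 ⟨a, 0, h0, by simp⟩, ?_⟩
        rw [NNReal.smul_def, map_smul, hwv, smul_zero]
    · right
      have hwp : 0 < w v0 := lt_of_le_of_ne (hw _ hv0) (Ne.symm hwv)
      refine ⟨⟨w, fun x hx => hw x (hsub hx), ?_⟩, hd⟩
      ext x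
      constructor
      · rintro ⟨hx, hwx⟩
        obtain ⟨a, t, ht, rfl⟩ := (hmem _).1 hx
        rw [map_add, NNReal.smul_def, map_smul, smul_eq_mul] at hwx
        have h1 := hw t (hsub ht)
        have h2 : 0 ≤ (a : ℝ) * w v0 := mul_nonneg a.2 hwp.le
        have h3 : (a : ℝ) * w v0 = 0 := by linarith
        have h4 : (a : ℝ) = 0 := (mul_eq_zero.1 h3).resolve_right hwv
        have h5 : w t = 0 := by linarith
        rw [NNReal.smul_def, h4, zero_smul, zero_add]
        exact ⟨ht, h5⟩
      · rintro ⟨hx, hwx⟩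
        exact ⟨hsub hx, hwx⟩
  have hcard : (raysOf (coneHull (τ ∪ {v0}))).ncard ≤ (raysOf τ).ncard + 1 :=
    (Set.ncard_le_ncard hrays (hfin.insert _)).trans (Set.ncard_insert_le _ _)
  have hdim : dimSet τ + 1 ≤ dimSet (coneHull (τ ∪ {v0})) := by
    apply Submodule.finrank_lt_finrank_of_lt
    refine lt_of_le_of_ne (Submodule.span_mono hsub) fun he => ?_
    have hm : v0 ∈ Submodule.span ℝ τ := by rw [he]; exact Submodule.subset_span hv0
    have hle : Submodule.span ℝ τ ≤ LinearMap.ker u := Submodule.span_le.2 fun x hx => hu x hx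
    exact hv.ne' (hle hm)
  simp only [nsCone]
  omega

theorem stmt3 {d : ℕ} (F : Set (Set (Fin d → ℝ))) (hF : IsFan F)
    (σ : Set (Fin d → ℝ)) (hσ : IsMinNonSimpCone F σ) (hns : 0 < nsCone σ)
    (v : Set (Fin d → ℝ) → (Fin d → ℝ))
    (hv : ∀ ρ ∈ raysOf σ, v ρ ∈ ρ ∧ v ρ ≠ 0)
    (v0 : Fin d → ℝ) (hv0 : v0 = ∑ᶠ ρ ∈ raysOf σ, v ρ)
    (μ : Set (Fin d → ℝ)) (hμ : μ ∈ F) (hσμ : σ ⊆ μ)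
    (τ : Set (Fin d → ℝ)) (hτ : IsFaceOf μ τ) (hστ : ¬ σ ⊆ τ) :
    nsCone (coneHull (τ ∪ {v0})) < nsCone σ := by
  have hle : ∀ κ ∈ F, nsCone κ ≤ nsFan F := fun κ hκ =>
    le_csSup (hF.1.image _).bddAbove (Set.mem_image_of_mem _ hκ)
  obtain ⟨hσF, hσns, hσmin⟩ := hσ
  have hτF : τ ∈ F := hF.2.2.1 μ hμ τ hτ
  have hγF : σ ∩ τ ∈ F := hF.2.2.1 σ hσF _ (hF.2.2.2 σ hσF τ hτF).1
  have hfin : ∀ κ ∈ F, (raysOf κ).Finite := by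
    intro κ hκ
    rw [raysOf_fan hF hκ]
    exact hF.1.subset fun x hx => hx.1
  obtain ⟨u, hu, hτe⟩ := hτ
  have hτμ : τ ⊆ μ := by rw [hτe]; exact fun x hx => hx.1
  have hlt : nsCone τ < nsCone σ := by
    rw [hσns]
    refine lt_of_le_of_ne (hle τ hτF) fun he => ?_
    have h1 := ns_super hF hσF hτF hμ hγF hσμ hτμ
    have h2 := hle μ hμ
    have h3 := hle _ hγF
    have := hσmin _ hγF (by omega) Set.inter_subset_left
    exact hστ (Set.inter_eq_left.1 this)
  refine lt_of_le_of_lt ?_ hlt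
  have hraysσ : ∀ ρ ∈ raysOf σ, ρ ⊆ σ := by
    rintro ρ ⟨⟨w, -, rfl⟩, -⟩
    exact fun x hx => hx.1
  have hnn : ∀ ρ ∈ raysOf σ, 0 ≤ u (v ρ) := fun ρ hρ =>
    hu _ (hσμ (hraysσ ρ hρ (hv ρ hρ).1))
  have hpos : 0 < u v0 := by
    rw [hv0, finsum_mem_eq_finite_toFinset_sum _ (hfin σ hσF), map_sum]
    have hnn' : ∀ ρ ∈ (hfin σ hσF).toFinset, 0 ≤ u (v ρ) := fun ρ hρ =>
      hnn ρ ((hfin σ hσF).mem_toFinset.1 hρ)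
    refine lt_of_le_of_ne (Finset.sum_nonneg hnn') fun he => ?_
    rw [eq_comm, Finset.sum_eq_zero_iff_of_nonneg hnn'] at he
    have hker : Submodule.span ℝ (⋃₀ raysOf σ) ≤ LinearMap.ker u := by
      rw [Submodule.span_le]
      rintro x ⟨ρ, hρ, hx⟩
      have hsp : Submodule.span ℝ {v ρ} = Submodule.span ℝ ρ := by
        apply Submodule.eq_of_le_of_finrank_eq
        · exact Submodule.span_mono (Set.singleton_subset_iff.2 (hv ρ hρ).1)
        · rw [finrank_span_singleton (hv ρ hρ).2]; exact hρ.2.symm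
      have hx' : x ∈ Submodule.span ℝ {v ρ} := hsp ▸ Submodule.subset_span hx
      obtain ⟨a, rfl⟩ := Submodule.mem_span_singleton.1 hx'
      have := he ρ ((hfin σ hσF).mem_toFinset.2 hρ)
      simp [this]
    rw [span_rays σ (hF.2.1 σ hσF).1 (hF.2.1 σ hσF).2] at hker
    apply hστ
    intro x hx
    rw [hτe]
    exact ⟨hσμ hx, hker (Submodule.subset_span hx)⟩
  obtain ⟨S, hS⟩ := (hF.2.1 τ hτF).1
  exact ns_cone_le τ v0 (Submodule.span NNReal S) (by rw [hS, coneHull_eq_span]) (hfin τ hτF) u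
    (fun x hx => by rw [hτe] at hx; exact hx.2) hpos
end
end
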